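/- In the near-separable setting with m = r, the positive semidefinite matrix A = (1 + ε/σ_min(W))⁻² · (WWᵀ)⁻¹ is feasible for the minimum-volume-ellipsoid SDP associated with M̃, i.e., m̃_iᵀ A m̃_i ≤ 1 for every column m̃_i of M̃. -/

import Mathlib

open Matrix BigOperators

/-- Euclidean norm of a vector in `ℝ^m`. -/
noncomputable def colNorm {m : ℕ} (v : Fin m → ℝ) : ℝ := Real.sqrt (∑ i, (v i) ^ 2)

/-- Largest singular value of a matrix. -/
noncomputable def sigmaMax {m n : ℕ} (X : Matrix (Fin m) (Fin n) ℝ) : ℝ :=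
  sSup {c : ℝ | ∃ v : Fin n → ℝ, colNorm v = 1 ∧ c = colNorm (X.mulVec v)}

/-- Smallest singular value of a matrix. -/
noncomputable def sigmaMin {m n : ℕ} (X : Matrix (Fin m) (Fin n) ℝ) : ℝ :=
  sInf {c : ℝ | ∃ v : Fin n → ℝ, colNorm v = 1 ∧ c = colNorm (X.mulVec v)}

/-- Condition number `κ(X) = σ_max(X) / σ_min(X)`. -/
noncomputable def kappa {m n : ℕ} (X : Matrix (Fin m) (Fin n) ℝ) : ℝ :=
  sigmaMax X / sigmaMin X

/-- Largest eigenvalue of a symmetric matrix, via the Rayleigh quotient. -/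
noncomputable def lamMax {r : ℕ} (C : Matrix (Fin r) (Fin r) ℝ) : ℝ :=
  sSup {c : ℝ | ∃ v : Fin r → ℝ, colNorm v = 1 ∧ c = v ⬝ᵥ C.mulVec v}

/-- Smallest eigenvalue of a symmetric matrix, via the Rayleigh quotient. -/
noncomputable def lamMin {r : ℕ} (C : Matrix (Fin r) (Fin r) ℝ) : ℝ :=
  sInf {c : ℝ | ∃ v : Fin r → ℝ, colNorm v = 1 ∧ c = v ⬝ᵥ C.mulVec v}

/-- Near-separable assumption with `m = r`: `Mt = W * H + N` where `W ∈ ℝ^{r×r}` is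
invertible, `H = [I_r, H']` is nonnegative with column sums at most one and whose first `r`
columns form the identity matrix, and each column of `N` has Euclidean norm at most `ε`. -/
def NearSepSquare (r n : ℕ) (W : Matrix (Fin r) (Fin r) ℝ) (H : Matrix (Fin r) (Fin n) ℝ)
    (N Mt : Matrix (Fin r) (Fin n) ℝ) (ε : ℝ) : Prop :=
  IsUnit W.det ∧ Mt = W * H + N ∧ (∀ i j, 0 ≤ H i j) ∧ (∀ j, ∑ i, H i j ≤ 1) ∧
    (∃ h : r ≤ n, ∀ i j : Fin r, H i (Fin.castLE h j) = if i = j then 1 else 0) ∧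
    0 ≤ ε ∧ ∀ j, colNorm (fun i => N i j) ≤ ε

/-- `A` is feasible for the minimum-volume-ellipsoid SDP associated with `Mt`:
`A` is positive semidefinite and `m̃ᵢᵀ A m̃ᵢ ≤ 1` for every column `m̃ᵢ` of `Mt`. -/
def SDPFeasible {r n : ℕ} (Mt : Matrix (Fin r) (Fin n) ℝ)
    (A : Matrix (Fin r) (Fin r) ℝ) : Prop :=
  A.PosSemidef ∧ ∀ j : Fin n, (fun i => Mt i j) ⬝ᵥ A.mulVec (fun i => Mt i j) ≤ 1

/-- `A` is an optimal solution of the minimum-volume-ellipsoid SDP associated with `Mt`: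
it is feasible and maximizes the determinant among the feasible matrices. -/
def SDPOptimal {r n : ℕ} (Mt : Matrix (Fin r) (Fin n) ℝ)
    (A : Matrix (Fin r) (Fin r) ℝ) : Prop :=
  SDPFeasible Mt A ∧ ∀ B : Matrix (Fin r) (Fin r) ℝ, SDPFeasible Mt B → B.det ≤ A.det

theorem colNorm_eq_norm_toLp {m : ℕ} (v : Fin m → ℝ) : colNorm v = ‖WithLp.toLp 2 v‖ := by
  simp [colNorm, EuclideanSpace.norm_eq]

theorem colNorm_nonneg {m : ℕ} (v : Fin m → ℝ) : 0 ≤ colNorm v := Real.sqrt_nonneg _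

theorem colNorm_add_le {m : ℕ} (v w : Fin m → ℝ) : colNorm (v + w) ≤ colNorm v + colNorm w := by
  simpa only [colNorm_eq_norm_toLp, WithLp.toLp_add] using
    norm_add_le (WithLp.toLp 2 v) (WithLp.toLp 2 w)

theorem colNorm_smul {m : ℕ} (c : ℝ) (v : Fin m → ℝ) : colNorm (c • v) = |c| * colNorm v := by
  simp only [colNorm_eq_norm_toLp, WithLp.toLp_smul, norm_smul, Real.norm_eq_abs]

theorem colNorm_pos {m : ℕ} {v : Fin m → ℝ} (hv : v ≠ 0) : 0 < colNorm v := by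
  rw [colNorm_eq_norm_toLp, norm_pos_iff]
  simpa using hv

theorem colNorm_sq {m : ℕ} (v : Fin m → ℝ) : colNorm v ^ 2 = v ⬝ᵥ v := by
  rw [colNorm, Real.sq_sqrt (Finset.sum_nonneg fun i _ => sq_nonneg _)]
  simp only [dotProduct, sq]

theorem colNorm_le_one_of_sum_le_one {m : ℕ} {v : Fin m → ℝ} (h0 : ∀ i, 0 ≤ v i)
    (h1 : ∑ i, v i ≤ 1) : colNorm v ≤ 1 := by
  rw [colNorm, Real.sqrt_le_one]
  refine le_trans (Finset.sum_le_sum fun i _ => ?_) h1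
  have hi : v i ≤ 1 := (Finset.single_le_sum (fun k _ => h0 k) (Finset.mem_univ i)).trans h1
  nlinarith [h0 i]

theorem exists_colNorm_mulVec_le {m n : ℕ} (X : Matrix (Fin m) (Fin n) ℝ) :
    ∃ K : ℝ, 0 < K ∧ ∀ v, colNorm (X.mulVec v) ≤ K * colNorm v := by
  obtain ⟨K, hK, h⟩ := (LinearMap.toContinuousLinearMap (Matrix.toEuclideanLin X)).bound
  refine ⟨K, hK, fun v => ?_⟩
  simpa [colNorm_eq_norm_toLp] using h (WithLp.toLp 2 v)

theorem sigmaMin_nonneg {m n : ℕ} (X : Matrix (Fin m) (Fin n) ℝ) : 0 ≤ sigmaMin X := by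
  refine Real.sInf_nonneg ?_
  rintro c ⟨v, -, rfl⟩
  exact colNorm_nonneg _

theorem colNorm_inv_smul_self {m : ℕ} {v : Fin m → ℝ} (hv : v ≠ 0) :
    colNorm ((colNorm v)⁻¹ • v) = 1 := by
  rw [colNorm_smul, abs_of_pos (inv_pos.2 (colNorm_pos hv)), inv_mul_cancel₀ (colNorm_pos hv).ne']

theorem sigmaMin_mul_colNorm_le {m n : ℕ} (X : Matrix (Fin m) (Fin n) ℝ) (v : Fin n → ℝ) :
    sigmaMin X * colNorm v ≤ colNorm (X.mulVec v) := by
  rcases eq_or_ne v 0 with rfl | hv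
  · simp [colNorm]
  have hpos := colNorm_pos hv
  have h : sigmaMin X ≤ colNorm (X.mulVec ((colNorm v)⁻¹ • v)) := by
    refine csInf_le ⟨0, ?_⟩ ⟨_, colNorm_inv_smul_self hv, rfl⟩
    rintro c ⟨w, -, rfl⟩
    exact colNorm_nonneg _
  rwa [Matrix.mulVec_smul, colNorm_smul, abs_of_pos (inv_pos.2 hpos), inv_mul_eq_div,
    le_div_iff₀ hpos] at h

theorem sigmaMin_pos {r : ℕ} {W : Matrix (Fin r) (Fin r) ℝ} (hW : IsUnit W.det)
    {v : Fin r → ℝ} (hv : v ≠ 0) : 0 < sigmaMin W := by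
  obtain ⟨K, hK, hb⟩ := exists_colNorm_mulVec_le W⁻¹
  refine lt_of_lt_of_le (inv_pos.2 hK) (le_csInf ⟨_, _, colNorm_inv_smul_self hv, rfl⟩ ?_)
  rintro c ⟨w, hw, rfl⟩
  have h := hb (W.mulVec w)
  rw [Matrix.mulVec_mulVec, Matrix.nonsing_inv_mul _ hW, Matrix.one_mulVec, hw] at h
  exact (inv_le_iff_one_le_mul₀' hK).2 h

theorem colNorm_inv_mulVec_le {r : ℕ} {W : Matrix (Fin r) (Fin r) ℝ} (hW : IsUnit W.det)
    (v : Fin r → ℝ) : colNorm (W⁻¹.mulVec v) ≤ colNorm v / sigmaMin W := by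
  rcases eq_or_ne v 0 with rfl | hv
  · simp [colNorm]
  have h := sigmaMin_mul_colNorm_le W (W⁻¹.mulVec v)
  rw [Matrix.mulVec_mulVec, Matrix.mul_nonsing_inv _ hW, Matrix.one_mulVec] at h
  rwa [le_div_iff₀' (sigmaMin_pos hW hv)]

/-- The matrix `A = (1 + ε/σ_min(W))⁻² (WWᵀ)⁻¹` is feasible for the
minimum-volume-ellipsoid SDP associated with `M̃`. -/
theorem scaled_inverse_feasible (r n : ℕ) (W : Matrix (Fin r) (Fin r) ℝ)
    (H : Matrix (Fin r) (Fin n) ℝ) (N Mt : Matrix (Fin r) (Fin n) ℝ) (ε : ℝ)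
    (hsep : NearSepSquare r n W H N Mt ε) :
    SDPFeasible Mt (((1 + ε / sigmaMin W) ^ 2)⁻¹ • (W * Wᵀ)⁻¹) := by
  obtain ⟨hW, rfl, hH0, hH1, -, hε, hN⟩ := hsep
  have hinv : (W * Wᵀ)⁻¹ = (W⁻¹)ᵀ * W⁻¹ := by
    rw [Matrix.mul_inv_rev, Matrix.transpose_nonsing_inv]
  have hratio : 0 ≤ ε / sigmaMin W := div_nonneg hε (sigmaMin_nonneg W)
  rw [hinv]
  refine ⟨?_, fun j => ?_⟩
  · have h := Matrix.posSemidef_conjTranspose_mul_self W⁻¹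
    rw [Matrix.conjTranspose_eq_transpose_of_trivial] at h
    exact h.smul (by positivity)
  set x : Fin r → ℝ := fun i => (W * H + N) i j
  have hx : W⁻¹.mulVec x = (fun i => H i j) + W⁻¹.mulVec (fun i => N i j) := by
    have hcol : x = W.mulVec (fun i => H i j) + fun i => N i j := rfl
    rw [hcol, Matrix.mulVec_add, Matrix.mulVec_mulVec, Matrix.nonsing_inv_mul _ hW,
      Matrix.one_mulVec]
  have hle : colNorm (W⁻¹.mulVec x) ≤ 1 + ε / sigmaMin W := by
    rw [hx]
    refine (colNorm_add_le _ _).trans (add_le_add ?_ ?_)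
    · exact colNorm_le_one_of_sum_le_one (fun i => hH0 i j) (hH1 j)
    · exact (colNorm_inv_mulVec_le hW _).trans
        (div_le_div_of_nonneg_right (hN j) (sigmaMin_nonneg W))
  have hquad : x ⬝ᵥ ((W⁻¹)ᵀ * W⁻¹).mulVec x = colNorm (W⁻¹.mulVec x) ^ 2 := by
    rw [colNorm_sq, ← Matrix.mulVec_mulVec, Matrix.dotProduct_mulVec, Matrix.vecMul_transpose]
  rw [Matrix.smul_mulVec, dotProduct_smul, hquad, smul_eq_mul, inv_mul_le_one₀ (by positivity)]
  exact pow_le_pow_left₀ (colNorm_nonneg _) hle 2
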